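/- Let m, n be positive integers and let a_1,…,a_9 and b_1,…,b_9 be nonnegative integers with a_1 ≥ a_2 ≥ … ≥ a_9. Suppose that: n² − (a_1²+…+a_9²) = −5, −3n + (a_1+…+a_9) = 3, m² − (b_1²+…+b_9²) = −2, −3m + (b_1+…+b_9) = 0, and mn − (a_1 b_1 + a_2 b_2 + … + a_9 b_9) = 1. Then n = 1, m = 1, (a_1,…,a_9) = (1,1,1,1,1,1,0,0,0) and (b_1,…,b_9) = (0,0,0,0,0,0,1,1,1). -/

import Mathlib

theorem aux_sq (x : ℕ) : (x : ℤ) ≤ (x : ℤ) ^ 2 := by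
  have : x ≤ x ^ 2 := Nat.le_self_pow (by norm_num) x
  exact_mod_cast this

theorem aux_le (x : ℕ) (h : (x : ℤ) ^ 2 ≤ x) : x ≤ 1 := by
  have h' : x ^ 2 ≤ x := by exact_mod_cast h
  nlinarith

theorem aux_ge (x : ℕ) : 2 * (x : ℤ) - 1 ≤ (x : ℤ) ^ 2 := by
  nlinarith [sq_nonneg ((x : ℤ) - 1)]

theorem aux_eq (x : ℕ) (h : (x : ℤ) ^ 2 ≤ 2 * (x : ℤ) - 1) : x = 1 := by
  have : ((x : ℤ) - 1) ^ 2 = 0 := le_antisymm (by nlinarith) (sq_nonneg _)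
  have := pow_eq_zero_iff (two_ne_zero) |>.1 this
  omega


/-- The combined numerical analysis in Proposition 3.2 (case II): the classes of
the (-5)-curve `R₂ = g*O(n) - Σ aᵢDᵢ` and the (-2)-curve `R₁ = g*O(m) - Σ bᵢDᵢ`
with `R₂² = -5`, `R₂·K = 3`, `R₁² = -2`, `R₁·K = 0`, `R₁·R₂ = 1` are uniquely
determined. -/
theorem stmt_2 (m n a1 a2 a3 a4 a5 a6 a7 a8 a9 b1 b2 b3 b4 b5 b6 b7 b8 b9 : ℕ)
    (hm : 1 ≤ m) (hn : 1 ≤ n)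
    (hord : a1 ≥ a2 ∧ a2 ≥ a3 ∧ a3 ≥ a4 ∧ a4 ≥ a5 ∧ a5 ≥ a6 ∧ a6 ≥ a7 ∧
      a7 ≥ a8 ∧ a8 ≥ a9)
    (h1 : (n : ℤ) ^ 2 - ((a1 : ℤ) ^ 2 + (a2 : ℤ) ^ 2 + (a3 : ℤ) ^ 2 + (a4 : ℤ) ^ 2 +
      (a5 : ℤ) ^ 2 + (a6 : ℤ) ^ 2 + (a7 : ℤ) ^ 2 + (a8 : ℤ) ^ 2 + (a9 : ℤ) ^ 2) = -5)
    (h2 : -3 * (n : ℤ) + ((a1 : ℤ) + (a2 : ℤ) + (a3 : ℤ) + (a4 : ℤ) + (a5 : ℤ) +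
      (a6 : ℤ) + (a7 : ℤ) + (a8 : ℤ) + (a9 : ℤ)) = 3)
    (h3 : (m : ℤ) ^ 2 - ((b1 : ℤ) ^ 2 + (b2 : ℤ) ^ 2 + (b3 : ℤ) ^ 2 + (b4 : ℤ) ^ 2 +
      (b5 : ℤ) ^ 2 + (b6 : ℤ) ^ 2 + (b7 : ℤ) ^ 2 + (b8 : ℤ) ^ 2 + (b9 : ℤ) ^ 2) = -2)
    (h4 : -3 * (m : ℤ) + ((b1 : ℤ) + (b2 : ℤ) + (b3 : ℤ) + (b4 : ℤ) + (b5 : ℤ) +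
      (b6 : ℤ) + (b7 : ℤ) + (b8 : ℤ) + (b9 : ℤ)) = 0)
    (h5 : (m : ℤ) * (n : ℤ) - ((a1 : ℤ) * (b1 : ℤ) + (a2 : ℤ) * (b2 : ℤ) +
      (a3 : ℤ) * (b3 : ℤ) + (a4 : ℤ) * (b4 : ℤ) + (a5 : ℤ) * (b5 : ℤ) +
      (a6 : ℤ) * (b6 : ℤ) + (a7 : ℤ) * (b7 : ℤ) + (a8 : ℤ) * (b8 : ℤ) +
      (a9 : ℤ) * (b9 : ℤ)) = 1) :
    n = 1 ∧ m = 1 ∧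
    (a1 = 1 ∧ a2 = 1 ∧ a3 = 1 ∧ a4 = 1 ∧ a5 = 1 ∧ a6 = 1 ∧ a7 = 0 ∧ a8 = 0 ∧ a9 = 0) ∧
    (b1 = 0 ∧ b2 = 0 ∧ b3 = 0 ∧ b4 = 0 ∧ b5 = 0 ∧ b6 = 0 ∧ b7 = 1 ∧ b8 = 1 ∧ b9 = 1) := by
  obtain ⟨o1, o2, o3, o4, o5, o6, o7, o8⟩ := hord
  have hn2 : n ≤ 2 := by
    have : (n : ℤ) ≤ 2 := by
      have k : ((n : ℤ) + 1) * (a1 + a2 + a3 + a4 + a5 + a6 + a7 + a8 + a9) = (n + 1) * (3 * n + 3) := by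
        congr 1; linarith
      linarith [sq_nonneg (3 * (a1 : ℤ) - (n + 1)), sq_nonneg (3 * (a2 : ℤ) - (n + 1)), sq_nonneg (3 * (a3 : ℤ) - (n + 1)), sq_nonneg (3 * (a4 : ℤ) - (n + 1)), sq_nonneg (3 * (a5 : ℤ) - (n + 1)), sq_nonneg (3 * (a6 : ℤ) - (n + 1)), sq_nonneg (3 * (a7 : ℤ) - (n + 1)), sq_nonneg (3 * (a8 : ℤ) - (n + 1)), sq_nonneg (3 * (a9 : ℤ) - (n + 1))]
    exact_mod_cast this
  have hc : n = 1 ∨ n = 2 := by omega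
  rcases hc with rfl | rfl
  · norm_num at h1 h2 h5
    have q1 := aux_sq a1
    have q2 := aux_sq a2
    have q3 := aux_sq a3
    have q4 := aux_sq a4
    have q5 := aux_sq a5
    have q6 := aux_sq a6
    have q7 := aux_sq a7
    have q8 := aux_sq a8
    have q9 := aux_sq a9
    have e1 := aux_le a1 (by linarith)
    have e2 := aux_le a2 (by linarith)
    have e3 := aux_le a3 (by linarith)
    have e4 := aux_le a4 (by linarith)
    have e5 := aux_le a5 (by linarith)
    have e6 := aux_le a6 (by linarith)
    have e7 := aux_le a7 (by linarith)
    have e8 := aux_le a8 (by linarith)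
    have e9 := aux_le a9 (by linarith)
    clear q1 q2 q3 q4 q5 q6 q7 q8 q9 h1
    obtain ⟨rfl, rfl, rfl, rfl, rfl, rfl, rfl, rfl, rfl⟩ : a1 = 1 ∧ a2 = 1 ∧ a3 = 1 ∧ a4 = 1 ∧ a5 = 1 ∧ a6 = 1 ∧ a7 = 0 ∧ a8 = 0 ∧ a9 = 0 := by omega
    norm_num at h5
    have hm1 : m = 1 := by
      have : (m : ℤ) ≤ 1 := by
        have k1 : ((m : ℤ) - 1) * (b1 + b2 + b3 + b4 + b5 + b6) = (m - 1) * (m - 1) := by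
          congr 1; linarith
        have k2 : (2 * (m : ℤ) + 1) * (b7 + b8 + b9) = (2 * m + 1) * (2 * m + 1) := by
          congr 1; linarith
        have k3 : (m : ℤ) ^ 2 + 2 * m ≤ 3 := by
          linarith [sq_nonneg (6 * (b1 : ℤ) - (m - 1)), sq_nonneg (6 * (b2 : ℤ) - (m - 1)), sq_nonneg (6 * (b3 : ℤ) - (m - 1)), sq_nonneg (6 * (b4 : ℤ) - (m - 1)), sq_nonneg (6 * (b5 : ℤ) - (m - 1)), sq_nonneg (6 * (b6 : ℤ) - (m - 1)), sq_nonneg (3 * (b7 : ℤ) - (2 * m + 1)), sq_nonneg (3 * (b8 : ℤ) - (2 * m + 1)), sq_nonneg (3 * (b9 : ℤ) - (2 * m + 1))]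
        by_contra hh
        have : (2 : ℤ) ≤ m := by omega
        have : (2 : ℤ) * 2 ≤ m * m := mul_le_mul this this (by norm_num) (by omega)
        linarith
      omega
    subst hm1
    norm_num at h3 h4 h5
    obtain ⟨rfl, rfl, rfl, rfl, rfl, rfl⟩ : b1 = 0 ∧ b2 = 0 ∧ b3 = 0 ∧ b4 = 0 ∧ b5 = 0 ∧ b6 = 0 := by omega
    norm_num at h3 h4
    have g7 := aux_sq b7
    have g8 := aux_sq b8
    have g9 := aux_sq b9
    have f7 := aux_le b7 (by linarith)
    have f8 := aux_le b8 (by linarith)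
    have f9 := aux_le b9 (by linarith)
    clear h3 g7 g8 g9
    omega
  · exfalso
    norm_num at h1 h2 h5
    have q1 := aux_ge a1
    have q2 := aux_ge a2
    have q3 := aux_ge a3
    have q4 := aux_ge a4
    have q5 := aux_ge a5
    have q6 := aux_ge a6
    have q7 := aux_ge a7
    have q8 := aux_ge a8
    have q9 := aux_ge a9
    have e1 := aux_eq a1 (by linarith)
    have e2 := aux_eq a2 (by linarith)
    have e3 := aux_eq a3 (by linarith)
    have e4 := aux_eq a4 (by linarith)
    have e5 := aux_eq a5 (by linarith)
    have e6 := aux_eq a6 (by linarith)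
    have e7 := aux_eq a7 (by linarith)
    have e8 := aux_eq a8 (by linarith)
    have e9 := aux_eq a9 (by linarith)
    subst e1 e2 e3 e4 e5 e6 e7 e8 e9
    norm_num at h5
    omega
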